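/- Triviality of the leading-order profile system (core of Theorem 2, case k = 0). Let γ > 0 and let p be a positive even integer. Let 𝒟 = {(R,Z) ∈ ℝ² : R ≤ 0}, let U₀, Ω₀ : 𝒟 → ℝ be C¹ up to the boundary and Ψ₀ : 𝒟 → ℝ be C² up to the boundary. Suppose that on 𝒟: (1−γ/2)U₀ + γ Y·∇U₀ + ∇^⊥Ψ₀·∇U₀ = 0; Ω₀ + γ Y·∇Ω₀ + ∇^⊥Ψ₀·∇Ω₀ = ∂_Z(U₀²); and −ΔΨ₀ = Ω₀. Assume: |U₀(Y)| + |Ω₀(Y)| → 0 and |∇Ψ₀(Y)|/|Y| → 0 as |Y| → ∞ (Y ∈ 𝒟); ∂_Z Ψ₀(0,Z) = 0 for every Z ∈ ℝ; and ∫_{{Y ∈ 𝒟 : ρ < |Y| < 2ρ}} (U₀(Y)^p + Ω₀(Y)^p) dY → 0 as ρ → ∞. Then U₀ ≡ 0 and Ω₀ ≡ 0 on 𝒟, and there exist constants a, b ∈ ℝ with Ψ₀(R,Z) = aR + b on 𝒟 (in particular ∂_Z Ψ₀ ≡ 0). -/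

import Mathlib

open MeasureTheory Filter

/-- Partial derivative in the first variable. -/
noncomputable def pd1 (f : ℝ → ℝ → ℝ) : ℝ → ℝ → ℝ := fun x y => deriv (fun s => f s y) x

/-- Partial derivative in the second variable. -/
noncomputable def pd2 (f : ℝ → ℝ → ℝ) : ℝ → ℝ → ℝ := fun x y => deriv (fun s => f x s) y


lemma aux_cutoff : ∃ χ χ' : ℝ → ℝ, (∀ s, HasDerivAt χ (χ' s) s) ∧ Continuous χ' ∧
    (∀ s, 0 ≤ χ s) ∧ (∀ s ≤ 1, χ s = 1) ∧ (∀ s, 4 ≤ s → χ s = 0) ∧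
    (∀ s ≤ 1, χ' s = 0) ∧ (∀ s, 4 ≤ s → χ' s = 0) ∧ ∃ C, 0 ≤ C ∧ ∀ s, |χ' s| ≤ C := by
  set χ : ℝ → ℝ := fun s => Real.smoothTransition ((4 - s) / 3) with hχ
  have hcd : ContDiff ℝ 1 χ := by
    have h1 : ContDiff ℝ 1 Real.smoothTransition := Real.smoothTransition.contDiff (n := 1)
    exact h1.comp (by fun_prop)
  have h1 : ∀ s ≤ 1, χ s = 1 := fun s hs => by
    apply Real.smoothTransition.one_of_one_le; linarith
  have h4 : ∀ s, 4 ≤ s → χ s = 0 := fun s hs => by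
    apply Real.smoothTransition.zero_of_nonpos; linarith
  have h0 : ∀ s, 0 ≤ χ s := fun s => Real.smoothTransition.nonneg _
  have hle : ∀ s, χ s ≤ 1 := fun s => Real.smoothTransition.le_one _
  have hc : Continuous (deriv χ) := hcd.continuous_deriv (by norm_num)
  have d1 : ∀ s ≤ 1, deriv χ s = 0 := fun s hs => by
    apply IsLocalMax.deriv_eq_zero
    exact Filter.Eventually.of_forall fun t => by simpa [h1 s hs] using hle t
  have d4 : ∀ s, 4 ≤ s → deriv χ s = 0 := fun s hs => by
    apply IsLocalMin.deriv_eq_zero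
    exact Filter.Eventually.of_forall fun t => by simpa [h4 s hs] using h0 t
  refine ⟨χ, deriv χ, fun s => (hcd.differentiable (by norm_num) s).hasDerivAt, hc, h0, h1, h4,
    d1, d4, ?_⟩
  obtain ⟨C, hC⟩ := (isCompact_Icc (a := (1:ℝ)) (b := 4)).exists_bound_of_continuousOn
    hc.continuousOn
  refine ⟨max C 0, le_max_right _ _, fun s => ?_⟩
  by_cases hs : s ≤ 1
  · simp [d1 s hs]
  by_cases hs' : 4 ≤ s
  · simp [d4 s hs']
  · exact (hC s ⟨by linarith, by linarith⟩).trans (le_max_left _ _)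

lemma aux_identity (γ c : ℝ) (k : ℕ) (V1 V2 u : ℝ × ℝ → ℝ)
    (hu : ContinuousOn u {q | q.1 ≤ 0}) (hV1 : ContinuousOn V1 {q | q.1 ≤ 0})
    (hV2 : ContinuousOn V2 {q | q.1 ≤ 0})
    (du : ∀ q : ℝ × ℝ, q.1 < 0 → DifferentiableAt ℝ u q)
    (dV1 : ∀ q : ℝ × ℝ, q.1 < 0 → DifferentiableAt ℝ V1 q)
    (dV2 : ∀ q : ℝ × ℝ, q.1 < 0 → DifferentiableAt ℝ V2 q)
    (heq : ∀ q : ℝ × ℝ, q.1 < 0 →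
      c * u q + (V1 q * fderiv ℝ u q (1, 0) + V2 q * fderiv ℝ u q (0, 1)) = 0)
    (hdiv : ∀ q : ℝ × ℝ, q.1 < 0 → fderiv ℝ V1 q (1, 0) + fderiv ℝ V2 q (0, 1) = 2 * γ)
    (hbd : ∀ Z : ℝ, V1 (0, Z) = 0)
    (χ χ' : ℝ → ℝ) (hχ : ∀ s, HasDerivAt χ (χ' s) s) (hχc : Continuous χ')
    (hχ4 : ∀ s, 4 ≤ s → χ s = 0) (ρ : ℝ) (hρ : 0 < ρ) :
    ∫ q in Set.Icc ((-(2 * ρ), -(2 * ρ)) : ℝ × ℝ) (0, 2 * ρ),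
      (u q ^ (k + 1) * (χ' ((q.1 ^ 2 + q.2 ^ 2) / ρ ^ 2) * (2 / ρ ^ 2) * (q.1 * V1 q + q.2 * V2 q))
       + (2 * γ - c * (k + 1 : ℕ)) * (χ ((q.1 ^ 2 + q.2 ^ 2) / ρ ^ 2) * u q ^ (k + 1))) = 0 := by
  set S := Set.Icc ((-(2 * ρ), -(2 * ρ)) : ℝ × ℝ) (0, 2 * ρ) with hS
  have hSD : S ⊆ {q | q.1 ≤ 0} := fun q hq => hq.2.1
  have hχcont : Continuous χ := continuous_iff_continuousAt.2 fun s => (hχ s).continuousAt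
  set φ : ℝ × ℝ → ℝ := fun q => χ ((q.1 ^ 2 + q.2 ^ 2) / ρ ^ 2) with hφ
  set H : ℝ × ℝ → ℝ := fun q => u q ^ (k + 1) * (χ' ((q.1 ^ 2 + q.2 ^ 2) / ρ ^ 2) * (2 / ρ ^ 2) * (q.1 * V1 q + q.2 * V2 q))
       + (2 * γ - c * (k + 1 : ℕ)) * (χ ((q.1 ^ 2 + q.2 ^ 2) / ρ ^ 2) * u q ^ (k + 1)) with hH
  have hφc : Continuous φ := by fun_prop
  have hHc : ContinuousOn H S := by
    have := hu.mono hSD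
    have := hV1.mono hSD
    have := hV2.mono hSD
    have : Continuous fun q : ℝ × ℝ => χ' ((q.1 ^ 2 + q.2 ^ 2) / ρ ^ 2) := by fun_prop
    have : ContinuousOn (fun q : ℝ × ℝ => χ' ((q.1 ^ 2 + q.2 ^ 2) / ρ ^ 2)) S := this.continuousOn
    have : ContinuousOn φ S := hφc.continuousOn
    simp only [hH]
    fun_prop
  set A : ℝ × ℝ → ℝ := fun q => φ q * u q ^ (k + 1) * V1 q with hA
  set B : ℝ × ℝ → ℝ := fun q => φ q * u q ^ (k + 1) * V2 q with hB
  have hφd : ∀ q : ℝ × ℝ, HasFDerivAt φ ((χ' ((q.1 ^ 2 + q.2 ^ 2) / ρ ^ 2)) •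
      ((2 / ρ ^ 2) • (q.1 • ContinuousLinearMap.fst ℝ ℝ ℝ + q.2 • ContinuousLinearMap.snd ℝ ℝ ℝ))) q := by
    intro q
    have h1 : HasFDerivAt (fun q : ℝ × ℝ => (q.1 ^ 2 + q.2 ^ 2) / ρ ^ 2)
      ((2 / ρ ^ 2) • (q.1 • ContinuousLinearMap.fst ℝ ℝ ℝ + q.2 • ContinuousLinearMap.snd ℝ ℝ ℝ)) q := by
      have := (((hasFDerivAt_fst (𝕜 := ℝ) (p := q)).pow 2).add
        ((hasFDerivAt_snd (𝕜 := ℝ) (p := q)).pow 2)).mul_const ((ρ ^ 2)⁻¹)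
      refine this.congr_fderiv ?_
      ext <;> simp <;> ring
    exact (hχ _).comp_hasFDerivAt q h1
  classical
  have hAd : ∀ q : ℝ × ℝ, q.1 < 0 → DifferentiableAt ℝ A q := fun q hq =>
    ((hφd q).differentiableAt.mul ((du q hq).pow _)).mul (dV1 q hq)
  have hBd : ∀ q : ℝ × ℝ, q.1 < 0 → DifferentiableAt ℝ B q := fun q hq =>
    ((hφd q).differentiableAt.mul ((du q hq).pow _)).mul (dV2 q hq)
  set f' : ℝ × ℝ → ℝ × ℝ →L[ℝ] ℝ := fun q =>
    if q.1 < 0 then fderiv ℝ A q else H q • ContinuousLinearMap.fst ℝ ℝ ℝ with hf'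
  set g' : ℝ × ℝ → ℝ × ℝ →L[ℝ] ℝ := fun q =>
    if q.1 < 0 then fderiv ℝ B q else 0 with hg'
  have key : ∀ q, f' q (1, 0) + g' q (0, 1) = H q := by
    intro q
    by_cases hq : q.1 < 0
    · have e1 := ((hφd q).mul ((du q hq).hasFDerivAt.pow (k + 1))).mul (dV1 q hq).hasFDerivAt
      have e2 := ((hφd q).mul ((du q hq).hasFDerivAt.pow (k + 1))).mul (dV2 q hq).hasFDerivAt
      have e1' : fderiv ℝ A q = _ := e1.fderiv
      have e2' : fderiv ℝ B q = _ := e2.fderiv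
      have h1 := heq q hq
      have h2 := hdiv q hq
      simp only [hf', hg', hq, if_true, e1', e2', hH, hφ]
      simp
      set a := fderiv ℝ u q (1, 0)
      set b := fderiv ℝ u q (0, 1)
      have h3 : fderiv ℝ V2 q (0, 1) = 2 * γ - fderiv ℝ V1 q (1, 0) := by linarith
      rw [h3]
      linear_combination (χ ((q.1 ^ 2 + q.2 ^ 2) / ρ ^ 2)) * (k + 1) * u q ^ k * h1
    · simp [hf', hg', hq]
  have hle : ((-(2 * ρ), -(2 * ρ)) : ℝ × ℝ) ≤ (0, 2 * ρ) := by
    constructor <;> simp <;> linarith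
  have hdivthm := integral_divergence_prod_Icc_of_hasFDerivAt_of_le A B f' g'
    (-(2 * ρ), -(2 * ρ)) (0, 2 * ρ) hle
    ((hφc.continuousOn.mul ((hu.mono hSD).pow _)).mul (hV1.mono hSD))
    ((hφc.continuousOn.mul ((hu.mono hSD).pow _)).mul (hV2.mono hSD))
    (fun q hq => by
      have hq' : q.1 < 0 := hq.1.2
      simp only [hf', hq', if_true]
      exact (hAd q hq').hasFDerivAt)
    (fun q hq => by
      have hq' : q.1 < 0 := hq.1.2
      simp only [hg', hq', if_true]
      exact (hBd q hq').hasFDerivAt)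
    (by simp only [key]; exact hHc.integrableOn_compact isCompact_Icc)
  simp only [key] at hdivthm
  rw [hdivthm]
  have z : ∀ q : ℝ × ℝ, 4 * ρ ^ 2 ≤ q.1 ^ 2 + q.2 ^ 2 → φ q = 0 := fun q hq => by
    apply hχ4
    rw [le_div_iff₀ (by positivity)]; exact hq
  have z1 : ∀ x, B (x, 2 * ρ) = 0 := fun x => by
    simp only [hB]; rw [z]; · simp
    simp only; nlinarith [sq_nonneg x]
  have z2 : ∀ x, B (x, -(2 * ρ)) = 0 := fun x => by
    simp only [hB]; rw [z]; · simp
    simp only; nlinarith [sq_nonneg x]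
  have z3 : ∀ x, A (-(2 * ρ), x) = 0 := fun x => by
    simp only [hA]; rw [z]; · simp
    simp only; nlinarith [sq_nonneg x]
  have z4 : ∀ x, A (0, x) = 0 := fun x => by
    simp [hA, hbd]
  simp [z1, z2, z3, z4]

lemma aux_transport (γ c : ℝ) (k : ℕ) (V1 V2 u : ℝ × ℝ → ℝ)
    (hu : ContinuousOn u {q | q.1 ≤ 0}) (hV1 : ContinuousOn V1 {q | q.1 ≤ 0})
    (hV2 : ContinuousOn V2 {q | q.1 ≤ 0})
    (du : ∀ q : ℝ × ℝ, q.1 < 0 → DifferentiableAt ℝ u q)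
    (dV1 : ∀ q : ℝ × ℝ, q.1 < 0 → DifferentiableAt ℝ V1 q)
    (dV2 : ∀ q : ℝ × ℝ, q.1 < 0 → DifferentiableAt ℝ V2 q)
    (heq : ∀ q : ℝ × ℝ, q.1 < 0 →
      c * u q + (V1 q * fderiv ℝ u q (1, 0) + V2 q * fderiv ℝ u q (0, 1)) = 0)
    (hdiv : ∀ q : ℝ × ℝ, q.1 < 0 → fderiv ℝ V1 q (1, 0) + fderiv ℝ V2 q (0, 1) = 2 * γ)
    (hbd : ∀ Z : ℝ, V1 (0, Z) = 0)
    (K M : ℝ) (hK : 0 ≤ K) (hVb : ∀ q : ℝ × ℝ, q.1 ≤ 0 → M < Real.sqrt (q.1 ^ 2 + q.2 ^ 2) →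
      |q.1 * V1 q + q.2 * V2 q| ≤ K * (q.1 ^ 2 + q.2 ^ 2))
    (hk : Even (k + 1)) (hne : c * (k + 1 : ℕ) ≠ 2 * γ)
    (hint : Tendsto (fun ρ : ℝ =>
      ∫ q in {q : ℝ × ℝ | q.1 ≤ 0 ∧ ρ < Real.sqrt (q.1 ^ 2 + q.2 ^ 2)
                ∧ Real.sqrt (q.1 ^ 2 + q.2 ^ 2) < 2 * ρ}, u q ^ (k + 1)) atTop (nhds 0)) :
    ∀ q : ℝ × ℝ, q.1 < 0 → u q = 0 := by
  obtain ⟨χ, χ', hχ, hχc, hχ0, hχ1, hχ4, hd1, hd4, C, hC0, hC⟩ := aux_cutoff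
  have hχcont : Continuous χ := continuous_iff_continuousAt.2 fun s => (hχ s).continuousAt
  intro q₀ hq₀
  set δ := 2 * γ - c * (k + 1 : ℕ) with hδ
  have hδ0 : 0 < |δ| := abs_pos.2 (fun h => hne (by linarith))
  obtain ⟨L, hL0, hL1, hL2⟩ : ∃ L : ℝ, 0 < L ∧ |q₀.1| < L ∧ |q₀.2| < L :=
    ⟨|q₀.1| + |q₀.2| + 1, by positivity, by linarith [abs_nonneg q₀.2], by linarith [abs_nonneg q₀.1]⟩
  set T := Set.Icc ((-L, -L) : ℝ × ℝ) (0, L) with hT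
  have hpos : ∀ q, 0 ≤ u q ^ (k + 1) := fun q => hk.pow_nonneg _
  set An : ℝ → Set (ℝ × ℝ) := fun ρ => {q : ℝ × ℝ | q.1 ≤ 0 ∧ ρ < Real.sqrt (q.1 ^ 2 + q.2 ^ 2)
                ∧ Real.sqrt (q.1 ^ 2 + q.2 ^ 2) < 2 * ρ} with hAn
  have hAm : ∀ ρ, MeasurableSet (An ρ) := fun ρ => by
    have hc : Continuous fun q : ℝ × ℝ => Real.sqrt (q.1 ^ 2 + q.2 ^ 2) := by fun_prop
    exact (measurableSet_le measurable_fst measurable_const).inter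
      ((measurableSet_lt measurable_const hc.measurable).inter
        (measurableSet_lt hc.measurable measurable_const))
  have hTint : IntegrableOn (fun q => u q ^ (k + 1)) T :=
    ((hu.mono fun q hq => hq.2.1).pow _).integrableOn_compact isCompact_Icc
  have main : ∀ ρ : ℝ, 2 * L + |M| < ρ →
      |δ| * ∫ q in T, u q ^ (k + 1) ≤ (C * 8 * K) * ∫ q in An ρ, u q ^ (k + 1) := by
    intro ρ hρ
    have hρ0 : 0 < ρ := by linarith [abs_nonneg M]
    have hMρ : M < ρ := by linarith [le_abs_self M]
    have hLρ : 2 * L < ρ := by linarith [abs_nonneg M]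
    have hid := aux_identity γ c k V1 V2 u hu hV1 hV2 du dV1 dV2 heq hdiv hbd χ χ' hχ hχc hχ4 ρ hρ0
    set S := Set.Icc ((-(2 * ρ), -(2 * ρ)) : ℝ × ℝ) (0, 2 * ρ) with hS
    have hSD : S ⊆ {q | q.1 ≤ 0} := fun q hq => hq.2.1
    have cu := hu.mono hSD
    have cV1 := hV1.mono hSD
    have cV2 := hV2.mono hSD
    have c1 : ContinuousOn (fun q : ℝ × ℝ => χ' ((q.1 ^ 2 + q.2 ^ 2) / ρ ^ 2)) S :=
      (by fun_prop : Continuous (fun q : ℝ × ℝ => χ' ((q.1 ^ 2 + q.2 ^ 2) / ρ ^ 2))).continuousOn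
    have c2 : ContinuousOn (fun q : ℝ × ℝ => χ ((q.1 ^ 2 + q.2 ^ 2) / ρ ^ 2)) S :=
      (by fun_prop : Continuous (fun q : ℝ × ℝ => χ ((q.1 ^ 2 + q.2 ^ 2) / ρ ^ 2))).continuousOn
    have i0 : IntegrableOn (fun q => u q ^ (k + 1)) S :=
      (cu.pow _).integrableOn_compact isCompact_Icc
    have i1 : IntegrableOn (fun q => u q ^ (k + 1) * (χ' ((q.1 ^ 2 + q.2 ^ 2) / ρ ^ 2) * (2 / ρ ^ 2) * (q.1 * V1 q + q.2 * V2 q))) S := by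
      refine ContinuousOn.integrableOn_compact isCompact_Icc ?_
      fun_prop
    have i2 : IntegrableOn (fun q => χ ((q.1 ^ 2 + q.2 ^ 2) / ρ ^ 2) * u q ^ (k + 1)) S := by
      refine ContinuousOn.integrableOn_compact isCompact_Icc ?_
      fun_prop
    rw [integral_add i1 (i2.const_mul _), integral_const_mul] at hid
    have hTS : T ⊆ S := Set.Icc_subset_Icc (by constructor <;> simp <;> linarith)
      (by constructor <;> simp; linarith)
    have hAS : An ρ ⊆ S := by
      rintro q ⟨h1, h2, h3⟩
      rw [Real.sqrt_lt' (by linarith)] at h3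
      have e1 := abs_le_of_sq_le_sq' (a := q.1) (b := 2 * ρ) (by nlinarith [sq_nonneg q.2]) (by linarith)
      have e2 := abs_le_of_sq_le_sq' (a := q.2) (b := 2 * ρ) (by nlinarith [sq_nonneg q.1]) (by linarith)
      exact ⟨⟨e1.1, e2.1⟩, ⟨h1, e2.2⟩⟩
    have s1 : ∫ q in T, u q ^ (k + 1) ≤ ∫ q in S, χ ((q.1 ^ 2 + q.2 ^ 2) / ρ ^ 2) * u q ^ (k + 1) := by
      calc ∫ q in T, u q ^ (k + 1) = ∫ q in T, χ ((q.1 ^ 2 + q.2 ^ 2) / ρ ^ 2) * u q ^ (k + 1) := by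
            apply setIntegral_congr_fun measurableSet_Icc
            rintro q ⟨⟨h1, h2⟩, h3, h4⟩
            simp only at h1 h2 h3 h4 ⊢
            rw [hχ1, one_mul]
            rw [div_le_one (by positivity)]
            nlinarith
        _ ≤ _ := setIntegral_mono_set i2 (Eventually.of_forall fun q => mul_nonneg (hχ0 _) (hpos q))
              hTS.eventuallyLE
    have s2 : |∫ q in S, u q ^ (k + 1) * (χ' ((q.1 ^ 2 + q.2 ^ 2) / ρ ^ 2) * (2 / ρ ^ 2) * (q.1 * V1 q + q.2 * V2 q))|
        ≤ (C * 8 * K) * ∫ q in An ρ, u q ^ (k + 1) := by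
      rw [← integral_const_mul, ← Set.inter_eq_right.2 hAS, ← setIntegral_indicator (hAm ρ)]
      rw [← Real.norm_eq_abs]
      apply norm_integral_le_of_norm_le
      · exact (i0.const_mul _).indicator (hAm ρ)
      · refine (ae_restrict_iff' measurableSet_Icc).2 (Eventually.of_forall fun q hq => ?_)
        by_cases hqA : q ∈ An ρ
        · rw [Set.indicator_of_mem hqA]
          obtain ⟨h1, h2, h3⟩ := hqA
          have hb := hVb q h1 (hMρ.trans h2)
          rw [Real.sqrt_lt' (by linarith)] at h3
          rw [Real.norm_eq_abs, abs_mul, abs_of_nonneg (hpos q), abs_mul, abs_mul,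
            abs_of_pos (by positivity : 0 < 2 / ρ ^ 2), mul_comm]
          refine mul_le_mul_of_nonneg_right ?_ (hpos q)
          calc _ ≤ C * (2 / ρ ^ 2) * (K * (4 * ρ ^ 2)) := by
                gcongr
                · exact hC _
                · refine hb.trans ?_
                  gcongr
                  nlinarith
            _ = C * 8 * K := by field_simp; ring
        · rw [Set.indicator_of_notMem hqA]
          have : χ' ((q.1 ^ 2 + q.2 ^ 2) / ρ ^ 2) = 0 := by
            by_cases h : (q.1 ^ 2 + q.2 ^ 2) / ρ ^ 2 ≤ 1
            · exact hd1 _ h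
            by_cases h' : 4 ≤ (q.1 ^ 2 + q.2 ^ 2) / ρ ^ 2
            · exact hd4 _ h'
            exfalso; apply hqA
            push Not at h h'
            rw [one_lt_div (by positivity)] at h
            rw [div_lt_iff₀ (by positivity)] at h'
            exact ⟨hSD hq, Real.lt_sqrt_of_sq_lt h, (Real.sqrt_lt' (by linarith)).2 (by linarith)⟩
          simp [this]
    have s3 : |δ| * (∫ q in S, χ ((q.1 ^ 2 + q.2 ^ 2) / ρ ^ 2) * u q ^ (k + 1)) =
       |∫ q in S, u q ^ (k + 1) * (χ' ((q.1 ^ 2 + q.2 ^ 2) / ρ ^ 2) * (2 / ρ ^ 2) * (q.1 * V1 q + q.2 * V2 q))| := by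
      rw [eq_neg_of_add_eq_zero_left hid, abs_neg, abs_mul, abs_of_nonneg (a := ∫ q in S, _)]
      exact integral_nonneg fun q => mul_nonneg (hχ0 _) (hpos q)
    calc _ ≤ _ := mul_le_mul_of_nonneg_left s1 hδ0.le
      _ = _ := s3
      _ ≤ _ := s2
  have hlim : |δ| * ∫ q in T, u q ^ (k + 1) ≤ 0 := by
    have := hint.const_mul (C * 8 * K)
    rw [mul_zero] at this
    exact ge_of_tendsto this ((eventually_gt_atTop _).mono main)
  have hz : ∫ q in T, u q ^ (k + 1) = 0 := by
    apply le_antisymm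
    · by_contra h
      push Not at h
      linarith [mul_pos hδ0 h]
    · exact integral_nonneg hpos
  rw [setIntegral_eq_zero_iff_of_nonneg_ae (Eventually.of_forall hpos) hTint] at hz
  set O : Set (ℝ × ℝ) := Set.Ioo (-L) 0 ×ˢ Set.Ioo (-L) L
  have hOT : O ⊆ T := fun q hq => ⟨⟨hq.1.1.le, hq.2.1.le⟩, ⟨hq.1.2.le, hq.2.2.le⟩⟩
  have hz' := ae_restrict_of_ae_restrict_of_subset hOT hz
  have := Measure.eqOn_open_of_ae_eq hz' (isOpen_Ioo.prod isOpen_Ioo)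
    ((hu.mono fun q hq => (hOT hq).2.1).pow _) continuousOn_const
  have h := this (x := q₀) ⟨⟨(abs_lt.1 hL1).1, hq₀⟩, abs_lt.1 hL2⟩
  exact pow_eq_zero_iff (by omega) |>.1 h

lemma aux_uniq : UniqueDiffOn ℝ {q : ℝ × ℝ | q.1 ≤ 0} := by
  have : {q : ℝ × ℝ | q.1 ≤ 0} = Set.Iic 0 ×ˢ Set.univ := by ext; simp
  rw [this]
  exact (uniqueDiffOn_Iic 0).prod uniqueDiffOn_univ

lemma aux_nhds (q : ℝ × ℝ) (hq : q.1 < 0) : {q : ℝ × ℝ | q.1 ≤ 0} ∈ nhds q :=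
  mem_of_superset ((isOpen_Iio.preimage continuous_fst).mem_nhds hq) fun q (h : q.1 < 0) => (le_of_lt h : q.1 ≤ 0)

lemma aux_closure : {q : ℝ × ℝ | q.1 ≤ 0} ⊆ closure {q : ℝ × ℝ | q.1 < 0} := by
  have : {q : ℝ × ℝ | q.1 < 0} = Set.Iio 0 ×ˢ Set.univ := by ext; simp
  rw [this, closure_prod_eq, closure_Iio, closure_univ]
  intro q hq; exact ⟨hq, trivial⟩

lemma aux_ext (f g : ℝ × ℝ → ℝ) (hf : ContinuousOn f {q | q.1 ≤ 0})
    (hg : ContinuousOn g {q | q.1 ≤ 0}) (h : ∀ q : ℝ × ℝ, q.1 < 0 → f q = g q) :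
    ∀ q : ℝ × ℝ, q.1 ≤ 0 → f q = g q := fun q hq =>
  Set.EqOn.of_subset_closure (s := {q : ℝ × ℝ | q.1 < 0}) (t := {q | q.1 ≤ 0}) h hf hg
    (fun q (h : q.1 < 0) => (le_of_lt h : q.1 ≤ 0)) aux_closure hq

lemma aux_liouville (P1 P2 : ℝ × ℝ → ℝ)
    (h1 : ContDiffOn ℝ 1 P1 {q | q.1 ≤ 0}) (h2 : ContDiffOn ℝ 1 P2 {q | q.1 ≤ 0})
    (cr1 : ∀ q : ℝ × ℝ, q.1 < 0 → fderiv ℝ P1 q (1, 0) + fderiv ℝ P2 q (0, 1) = 0)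
    (cr2 : ∀ q : ℝ × ℝ, q.1 < 0 → fderiv ℝ P1 q (0, 1) = fderiv ℝ P2 q (1, 0))
    (hbc : ∀ Z : ℝ, P2 (0, Z) = 0)
    (hgr : ∀ ε > 0, ∃ M : ℝ, ∀ q : ℝ × ℝ, q.1 ≤ 0 → M < Real.sqrt (q.1 ^ 2 + q.2 ^ 2) →
      Real.sqrt (P1 q ^ 2 + P2 q ^ 2) ≤ ε * Real.sqrt (q.1 ^ 2 + q.2 ^ 2)) :
    ∃ a : ℝ, ∀ q : ℝ × ℝ, q.1 ≤ 0 → P1 q = a ∧ P2 q = 0 := by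
  set D : Set (ℝ × ℝ) := {q | q.1 ≤ 0} with hD
  set L1 := fderivWithin ℝ P1 D
  set L2 := fderivWithin ℝ P2 D
  have cL1 : ContinuousOn L1 D := h1.continuousOn_fderivWithin aux_uniq (by norm_num)
  have cL2 : ContinuousOn L2 D := h2.continuousOn_fderivWithin aux_uniq (by norm_num)
  have d1 : ∀ q ∈ D, HasFDerivWithinAt P1 (L1 q) D q := fun q hq =>
    (h1.differentiableOn (by norm_num) q hq).hasFDerivWithinAt
  have d2 : ∀ q ∈ D, HasFDerivWithinAt P2 (L2 q) D q := fun q hq =>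
    (h2.differentiableOn (by norm_num) q hq).hasFDerivWithinAt
  have e1 : ∀ q ∈ D, L2 q (0, 1) = - L1 q (1, 0) :=
    aux_ext _ _ (cL2.clm_apply continuousOn_const) (cL1.clm_apply continuousOn_const).neg
      (fun q hq => by
        have := cr1 q hq
        have hn : D ∈ nhds q := aux_nhds q hq
        simp only [L1, L2, fderivWithin_of_mem_nhds hn]
        linarith)
  have e2 : ∀ q ∈ D, L2 q (1, 0) = L1 q (0, 1) :=
    aux_ext _ _ (cL2.clm_apply continuousOn_const) (cL1.clm_apply continuousOn_const)
      (fun q hq => by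
        have := cr2 q hq
        have hn : D ∈ nhds q := aux_nhds q hq
        simp only [L1, L2, fderivWithin_of_mem_nhds hn]
        linarith)
  have e3 : ∀ Z, L1 (0, Z) (1, 0) = 0 := fun Z => by
    have hc : HasDerivAt (fun s : ℝ => ((0 : ℝ), s)) ((0 : ℝ), (1 : ℝ)) Z :=
      (hasDerivAt_const Z (0 : ℝ)).prodMk (hasDerivAt_id Z)
    have hh := (d2 (0, Z) (by simp [hD])).comp_hasDerivWithinAt (s := Set.univ) Z
      hc.hasDerivWithinAt (fun s _ => by simp [hD])
    have h0 : (P2 ∘ fun s : ℝ => ((0 : ℝ), s)) = fun _ => 0 := by ext s; simp [hbc]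
    rw [h0, hasDerivWithinAt_univ] at hh
    have := hh.unique (hasDerivAt_const Z (0 : ℝ))
    rw [e1 _ (by simp [hD])] at this
    linarith
  set DC : Set ℂ := {z | z.re ≤ 0} with hDC
  set ι : ℂ → ℝ × ℝ := fun z => (z.re, z.im) with hι
  set g : ℂ → ℂ := fun z => (P1 (ι z) : ℂ) - Complex.I * (P2 (ι z) : ℂ) with hg
  set lam : ℂ → ℂ := fun z => (L1 (ι z) (1, 0) : ℂ) - Complex.I * (L1 (ι z) (0, 1) : ℂ) with hlam
  have hdec : ∀ (L : ℝ × ℝ →L[ℝ] ℝ) (a b : ℝ), L (a, b) = a * L (1, 0) + b * L (0, 1) := by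
    intro L a b
    have : ((a, b) : ℝ × ℝ) = a • (1, 0) + b • (0, 1) := by simp
    rw [this, map_add, map_smul, map_smul]; simp
  have hgr' : ∀ z ∈ DC, HasFDerivWithinAt g
      ((ContinuousLinearMap.toSpanSingleton ℂ (lam z)).restrictScalars ℝ) DC z := by
    intro z hz
    have hι' : HasFDerivWithinAt ι (Complex.reCLM.prod Complex.imCLM) DC z :=
      (Complex.reCLM.prod Complex.imCLM).hasFDerivAt.hasFDerivWithinAt
    have a1 := (d1 (ι z) hz).comp z hι' (fun w hw => hw)
    have a2 := (d2 (ι z) hz).comp z hι' (fun w hw => hw)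
    have b1 := (Complex.ofRealCLM.hasFDerivAt (x := P1 (ι z))).comp_hasFDerivWithinAt z a1
    have b2 := (Complex.ofRealCLM.hasFDerivAt (x := P2 (ι z))).comp_hasFDerivWithinAt z a2
    have b3 := b1.sub (b2.const_mul Complex.I)
    refine b3.congr_fderiv ?_
    refine ContinuousLinearMap.ext fun w => ?_
    have r1 := hdec (L1 (ι z)) w.re w.im
    have r2 := hdec (L2 (ι z)) w.re w.im
    rw [e1 _ hz, e2 _ hz] at r2
    apply Complex.ext <;> simp [hlam, r1, r2] <;> ring
  have hgd : ∀ z ∈ DC, HasDerivWithinAt g (lam z) DC z := fun z hz =>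
    HasFDerivWithinAt.of_restrictScalars ℝ (hgr' z hz) rfl
  set G2 : ℂ → ℂ := fun z => (starRingEnd ℂ) (g (-(starRingEnd ℂ) z)) with hG2
  set DC2 : Set ℂ := {z | 0 ≤ z.re} with hDC2
  have hgd2 : ∀ z ∈ DC2, HasDerivWithinAt G2 (-(starRingEnd ℂ) (lam (-(starRingEnd ℂ) z))) DC2 z := by
    intro z hz
    have k1 : HasFDerivWithinAt (fun z : ℂ => -(starRingEnd ℂ) z) (-(Complex.conjCLE : ℂ →L[ℝ] ℂ)) DC2 z :=
      (-(Complex.conjCLE : ℂ →L[ℝ] ℂ)).hasFDerivAt.hasFDerivWithinAt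
    have k2 := (hgr' (-(starRingEnd ℂ) z) (by simpa [hDC, hDC2] using hz)).comp z k1
      (fun w hw => by simpa [hDC, hDC2] using hw)
    have k3 := ((Complex.conjCLE : ℂ →L[ℝ] ℂ).hasFDerivAt
      (x := g (-(starRingEnd ℂ) z))).comp_hasFDerivWithinAt z k2
    refine HasFDerivWithinAt.of_restrictScalars ℝ k3 ?_
    refine ContinuousLinearMap.ext fun w => ?_
    simp
  set G : ℂ → ℂ := fun z => if z.re ≤ 0 then g z else G2 z with hG
  have hGl : ∀ z ∈ DC, G z = g z := fun z (hz : z.re ≤ 0) => by simp [hG, hz]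
  have hGr : ∀ z ∈ DC2, G z = G2 z := fun z (hz : 0 ≤ z.re) => by
    by_cases h : z.re ≤ 0
    · have h0 : z.re = 0 := le_antisymm h hz
      have hz' : -(starRingEnd ℂ) z = z := by apply Complex.ext <;> simp [h0]
      simp only [hG, h, if_true, hG2, hz']
      simp only [hg, hι, h0, hbc]
      simp
    · simp [hG, h]
  have hGdiff : Differentiable ℂ G := by
    intro z
    have l : ∀ z ∈ DC, HasDerivWithinAt G (lam z) DC z := fun z hz =>
      (hgd z hz).congr hGl (hGl z hz)
    have r : ∀ z ∈ DC2, HasDerivWithinAt G (-(starRingEnd ℂ) (lam (-(starRingEnd ℂ) z))) DC2 z :=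
      fun z hz => (hgd2 z hz).congr hGr (hGr z hz)
    rcases lt_trichotomy z.re 0 with h | h | h
    · refine ((l z h.le).hasDerivAt ?_).differentiableAt
      exact mem_of_superset ((isOpen_Iio.preimage Complex.continuous_re).mem_nhds h)
        fun q (h : q.re < 0) => (le_of_lt h : q.re ≤ 0)
    · have hz' : -(starRingEnd ℂ) z = z := by apply Complex.ext <;> simp [h]
      have hl := l z h.le
      have hr := r z h.ge
      have hlam' : -(starRingEnd ℂ) (lam (-(starRingEnd ℂ) z)) = lam z := by
        rw [hz']
        simp only [hlam, hι, h, e3]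
        simp
      rw [hlam'] at hr
      have hu := hl.union hr
      have : DC ∪ DC2 = Set.univ := by
        ext w; simp [hDC, hDC2, le_total]
      rw [this, hasDerivWithinAt_univ] at hu
      exact hu.differentiableAt
    · refine ((r z h.le).hasDerivAt ?_).differentiableAt
      exact mem_of_superset ((isOpen_Ioi.preimage Complex.continuous_re).mem_nhds h)
        fun q (h : 0 < q.re) => (le_of_lt h : 0 ≤ q.re)
  have hnorm : ∀ z, ‖g z‖ = Real.sqrt (P1 (ι z) ^ 2 + P2 (ι z) ^ 2) := fun z => by
    rw [Complex.norm_def, Complex.normSq_apply]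
    simp [hg]; ring_nf
  have hnz : ∀ z : ℂ, ‖z‖ = Real.sqrt ((ι z).1 ^ 2 + (ι z).2 ^ 2) := fun z => by
    rw [Complex.norm_def, Complex.normSq_apply]
    simp [hι]; ring_nf
  have hGb : ∀ ε > 0, ∃ M : ℝ, ∀ z, M < ‖z‖ → ‖G z‖ ≤ ε * ‖z‖ := by
    intro ε hε
    obtain ⟨M, hM⟩ := hgr ε hε
    have hgb : ∀ z ∈ DC, M < ‖z‖ → ‖g z‖ ≤ ε * ‖z‖ := fun z hz h => by
      rw [hnorm, hnz]
      exact hM (ι z) hz (by rwa [hnz] at h)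
    refine ⟨M, fun z hz => ?_⟩
    rcases le_total z.re 0 with h | h
    · rw [hGl z h]; exact hgb z h hz
    · rw [hGr z h]
      have := hgb (-(starRingEnd ℂ) z) (by simpa [hDC] using h) (by simpa using hz)
      simpa [hG2] using this
  have hG0 : ∀ z, deriv G z = 0 := by
    intro z
    rw [← norm_le_zero_iff]
    refine le_of_forall_pos_le_add fun ε hε => ?_
    obtain ⟨M, hM⟩ := hGb (ε / 2) (by positivity)
    set R := |M| + ‖z‖ + ‖z‖ + 1 with hR
    have hR0 : 0 < R := by positivity
    have := Complex.norm_deriv_le_of_forall_mem_sphere_norm_le (c := z) (R := R) (C := ε * R) hR0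
      hGdiff.diffContOnCl (fun w hw => by
        have hw' : ‖w - z‖ = R := by simpa using hw
        have t1 : R - ‖z‖ ≤ ‖w‖ := by
          have := norm_sub_le w z
          linarith
        have t2 : ‖w‖ ≤ R + ‖z‖ := by
          have := norm_add_le (w - z) z
          rw [sub_add_cancel] at this
          linarith
        have := hM w (by linarith [le_abs_self M, norm_nonneg z])
        refine this.trans ?_
        have : ‖w‖ ≤ 2 * R := by linarith [abs_nonneg M, norm_nonneg z]
        nlinarith)
    rw [mul_div_assoc, div_self hR0.ne'] at this
    linarith
  have hconst := is_const_of_deriv_eq_zero hGdiff hG0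
  have hfin : ∀ z ∈ DC, g z = g 0 := fun z hz => by
    rw [← hGl z hz, ← hGl 0 (by simp [hDC])]; exact hconst z 0
  refine ⟨P1 (0, 0), fun q hq => ?_⟩
  have := hfin ⟨q.1, q.2⟩ hq
  have r := congrArg Complex.re this
  have i := congrArg Complex.im this
  simp [hg, hι, hbc] at r i
  exact ⟨r, i⟩

lemma aux_pd1 (f : ℝ → ℝ → ℝ) (q : ℝ × ℝ)
    (h : DifferentiableAt ℝ (fun q : ℝ × ℝ => f q.1 q.2) q) :
    pd1 f q.1 q.2 = fderiv ℝ (fun q : ℝ × ℝ => f q.1 q.2) q (1, 0) := by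
  have hc : HasDerivAt (fun s : ℝ => (s, q.2)) ((1 : ℝ), (0 : ℝ)) q.1 :=
    (hasDerivAt_id q.1).prodMk (hasDerivAt_const q.1 q.2)
  exact (h.hasFDerivAt.comp_hasDerivAt q.1 hc).deriv

lemma aux_pd2 (f : ℝ → ℝ → ℝ) (q : ℝ × ℝ)
    (h : DifferentiableAt ℝ (fun q : ℝ × ℝ => f q.1 q.2) q) :
    pd2 f q.1 q.2 = fderiv ℝ (fun q : ℝ × ℝ => f q.1 q.2) q (0, 1) := by
  have hc : HasDerivAt (fun s : ℝ => (q.1, s)) ((0 : ℝ), (1 : ℝ)) q.2 :=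
    (hasDerivAt_const q.2 q.1).prodMk (hasDerivAt_id q.2)
  exact (h.hasFDerivAt.comp_hasDerivAt q.2 hc).deriv

lemma aux_pd2_within (f : ℝ → ℝ → ℝ) (q : ℝ × ℝ) (hq : q.1 ≤ 0)
    (h : DifferentiableWithinAt ℝ (fun q : ℝ × ℝ => f q.1 q.2) {q | q.1 ≤ 0} q) :
    pd2 f q.1 q.2 = fderivWithin ℝ (fun q : ℝ × ℝ => f q.1 q.2) {q | q.1 ≤ 0} q (0, 1) := by
  have hc : HasDerivAt (fun s : ℝ => (q.1, s)) ((0 : ℝ), (1 : ℝ)) q.2 :=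
    (hasDerivAt_const q.2 q.1).prodMk (hasDerivAt_id q.2)
  have := h.hasFDerivWithinAt.comp_hasDerivWithinAt (s := Set.univ) q.2
    hc.hasDerivWithinAt (fun s _ => hq)
  rw [hasDerivWithinAt_univ] at this
  exact this.deriv

lemma aux_squeeze (u w : ℝ × ℝ → ℝ) (p k : ℕ) (hp : Even p) (hk : Even k) (hpk : p ≤ k)
    (hu : ContinuousOn u {q | q.1 ≤ 0}) (hw : ContinuousOn w {q | q.1 ≤ 0})
    (M : ℝ) (hM : ∀ q : ℝ × ℝ, q.1 ≤ 0 → M < Real.sqrt (q.1 ^ 2 + q.2 ^ 2) → |u q| ≤ 1)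
    (hint : Tendsto (fun ρ : ℝ =>
      ∫ q in {q : ℝ × ℝ | q.1 ≤ 0 ∧ ρ < Real.sqrt (q.1 ^ 2 + q.2 ^ 2)
                ∧ Real.sqrt (q.1 ^ 2 + q.2 ^ 2) < 2 * ρ}, (u q ^ p + w q ^ p)) atTop (nhds 0)) :
    Tendsto (fun ρ : ℝ =>
      ∫ q in {q : ℝ × ℝ | q.1 ≤ 0 ∧ ρ < Real.sqrt (q.1 ^ 2 + q.2 ^ 2)
                ∧ Real.sqrt (q.1 ^ 2 + q.2 ^ 2) < 2 * ρ}, u q ^ k) atTop (nhds 0) := by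
  refine squeeze_zero' (Eventually.of_forall fun ρ => integral_nonneg fun q => hk.pow_nonneg _) ?_ hint
  filter_upwards [eventually_gt_atTop (max M 0)] with ρ hρ
  have hρ0 : 0 < ρ := (le_max_right _ _).trans_lt hρ
  have hMρ : M < ρ := (le_max_left _ _).trans_lt hρ
  set An : Set (ℝ × ℝ) := {q : ℝ × ℝ | q.1 ≤ 0 ∧ ρ < Real.sqrt (q.1 ^ 2 + q.2 ^ 2)
                ∧ Real.sqrt (q.1 ^ 2 + q.2 ^ 2) < 2 * ρ} with hAn
  have hAm : MeasurableSet An := by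
    have hc : Continuous fun q : ℝ × ℝ => Real.sqrt (q.1 ^ 2 + q.2 ^ 2) := by fun_prop
    exact (measurableSet_le measurable_fst measurable_const).inter
      ((measurableSet_lt measurable_const hc.measurable).inter
        (measurableSet_lt hc.measurable measurable_const))
  have hAS : An ⊆ Set.Icc ((-(2 * ρ), -(2 * ρ)) : ℝ × ℝ) (0, 2 * ρ) := by
    rintro q ⟨h1, h2, h3⟩
    rw [Real.sqrt_lt' (by linarith)] at h3
    have e1 := abs_le_of_sq_le_sq' (a := q.1) (b := 2 * ρ) (by nlinarith [sq_nonneg q.2]) (by linarith)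
    have e2 := abs_le_of_sq_le_sq' (a := q.2) (b := 2 * ρ) (by nlinarith [sq_nonneg q.1]) (by linarith)
    exact ⟨⟨e1.1, e2.1⟩, ⟨h1, e2.2⟩⟩
  have hSD : Set.Icc ((-(2 * ρ), -(2 * ρ)) : ℝ × ℝ) (0, 2 * ρ) ⊆ {q | q.1 ≤ 0} := fun q hq => hq.2.1
  refine setIntegral_mono_on ?_ ?_ hAm ?_
  · exact (((hu.mono hSD).pow k).integrableOn_compact isCompact_Icc).mono_set hAS
  · exact ((((hu.mono hSD).pow p).add ((hw.mono hSD).pow p)).integrableOn_compact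
      isCompact_Icc).mono_set hAS
  · intro q hq
    have h1 := hM q hq.1 (hMρ.trans hq.2.1)
    have h2 : 0 ≤ w q ^ p := hp.pow_nonneg _
    have h3 : u q ^ k ≤ u q ^ p := by
      rw [← hk.pow_abs, ← hp.pow_abs]
      exact pow_le_pow_of_le_one (abs_nonneg _) h1 hpk
    linarith

lemma aux_expo (c γ : ℝ) (hγ : 0 < γ) (p : ℕ) (hp : 0 < p) (hpeven : Even p) :
    ∃ k : ℕ, Even (k + 1) ∧ p ≤ k + 1 ∧ c * (k + 1 : ℕ) ≠ 2 * γ := by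
  by_cases h : c * p = 2 * γ
  · refine ⟨p + 1, by simpa [add_assoc] using hpeven.add (by decide : Even 2), by omega, fun h' => ?_⟩
    push_cast at h'
    have : c = 0 := by linarith
    subst this
    linarith
  · refine ⟨p - 1, by rwa [Nat.sub_add_cancel hp], by omega, by rwa [Nat.sub_add_cancel hp]⟩

/-- **Triviality of the leading-order profile system (core of Theorem 2, case `k = 0`).**
Let `γ > 0`, `p` a positive even integer, `U₀, Ω₀ ∈ C¹(𝒟)`, `Ψ₀ ∈ C²(𝒟)` on the closed
left half-plane `𝒟 = {(R,Z) : R ≤ 0}` satisfying on `𝒟`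
`(1−γ/2)U₀ + γ Y·∇U₀ + ∇^⊥Ψ₀·∇U₀ = 0`,
`Ω₀ + γ Y·∇Ω₀ + ∇^⊥Ψ₀·∇Ω₀ = ∂_Z(U₀²)`, and `−ΔΨ₀ = Ω₀`.
Assume `|U₀(Y)| + |Ω₀(Y)| → 0` and `|∇Ψ₀(Y)|/|Y| → 0` as `|Y| → ∞` in `𝒟`,
`∂_Z Ψ₀(0,Z) = 0` for all `Z`, and the annulus integrals of `U₀^p + Ω₀^p` tend to `0`.
Then `U₀ ≡ 0`, `Ω₀ ≡ 0` and `Ψ₀(R,Z) = aR + b` on `𝒟` for some constants `a, b`. -/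
theorem leading_order_profile_triviality
    (γ : ℝ) (hγ : 0 < γ) (p : ℕ) (hp : 0 < p) (hpeven : Even p)
    (U W Ψ : ℝ → ℝ → ℝ)
    (hU : ContDiffOn ℝ 1 (fun q : ℝ × ℝ => U q.1 q.2) {q : ℝ × ℝ | q.1 ≤ 0})
    (hW : ContDiffOn ℝ 1 (fun q : ℝ × ℝ => W q.1 q.2) {q : ℝ × ℝ | q.1 ≤ 0})
    (hΨ : ContDiffOn ℝ 2 (fun q : ℝ × ℝ => Ψ q.1 q.2) {q : ℝ × ℝ | q.1 ≤ 0})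
    (heqU : ∀ R ≤ (0 : ℝ), ∀ Z : ℝ,
      (1 - γ / 2) * U R Z + γ * (R * pd1 U R Z + Z * pd2 U R Z)
        + (-(pd2 Ψ R Z) * pd1 U R Z + pd1 Ψ R Z * pd2 U R Z) = 0)
    (heqW : ∀ R ≤ (0 : ℝ), ∀ Z : ℝ,
      W R Z + γ * (R * pd1 W R Z + Z * pd2 W R Z)
        + (-(pd2 Ψ R Z) * pd1 W R Z + pd1 Ψ R Z * pd2 W R Z)
        = pd2 (fun a b => (U a b) ^ 2) R Z)
    (heqΨ : ∀ R ≤ (0 : ℝ), ∀ Z : ℝ,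
      -(pd1 (pd1 Ψ) R Z + pd2 (pd2 Ψ) R Z) = W R Z)
    (hdecay : ∀ ε > 0, ∃ M : ℝ, ∀ R ≤ (0 : ℝ), ∀ Z : ℝ,
      M < Real.sqrt (R ^ 2 + Z ^ 2) → |U R Z| + |W R Z| < ε)
    (hgrad : ∀ ε > 0, ∃ M : ℝ, ∀ R ≤ (0 : ℝ), ∀ Z : ℝ,
      M < Real.sqrt (R ^ 2 + Z ^ 2) →
      Real.sqrt ((pd1 Ψ R Z) ^ 2 + (pd2 Ψ R Z) ^ 2) ≤ ε * Real.sqrt (R ^ 2 + Z ^ 2))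
    (hbc : ∀ Z : ℝ, pd2 Ψ 0 Z = 0)
    (hint : Tendsto (fun ρ : ℝ =>
      ∫ q in {q : ℝ × ℝ | q.1 ≤ 0 ∧ ρ < Real.sqrt (q.1 ^ 2 + q.2 ^ 2)
                ∧ Real.sqrt (q.1 ^ 2 + q.2 ^ 2) < 2 * ρ},
        ((U q.1 q.2) ^ p + (W q.1 q.2) ^ p))
      atTop (nhds 0)) :
    (∀ R ≤ (0 : ℝ), ∀ Z : ℝ, U R Z = 0 ∧ W R Z = 0)
    ∧ ∃ a b : ℝ, ∀ R ≤ (0 : ℝ), ∀ Z : ℝ, Ψ R Z = a * R + b := by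
  set D : Set (ℝ × ℝ) := {q : ℝ × ℝ | q.1 ≤ 0} with hD
  set u : ℝ × ℝ → ℝ := fun q => U q.1 q.2 with hu_def
  set w : ℝ × ℝ → ℝ := fun q => W q.1 q.2 with hw_def
  set F : ℝ × ℝ → ℝ := fun q => Ψ q.1 q.2 with hF_def
  have hn : ∀ q : ℝ × ℝ, q.1 < 0 → D ∈ nhds q := aux_nhds
  set P1 : ℝ × ℝ → ℝ := fun q => fderivWithin ℝ F D q (1, 0) with hP1
  set P2 : ℝ × ℝ → ℝ := fun q => fderivWithin ℝ F D q (0, 1) with hP2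
  have hF' : ContDiffOn ℝ 1 (fderivWithin ℝ F D) D := hΨ.fderivWithin aux_uniq (by norm_num)
  have cP1 : ContDiffOn ℝ 1 P1 D := hF'.clm_apply contDiffOn_const
  have cP2 : ContDiffOn ℝ 1 P2 D := hF'.clm_apply contDiffOn_const
  have dF : ∀ q : ℝ × ℝ, q.1 < 0 → DifferentiableAt ℝ F q := fun q hq =>
    (hΨ.contDiffAt (hn q hq)).differentiableAt (by norm_num)
  have du : ∀ q : ℝ × ℝ, q.1 < 0 → DifferentiableAt ℝ u q := fun q hq =>
    (hU.contDiffAt (hn q hq)).differentiableAt (by norm_num)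
  have dw : ∀ q : ℝ × ℝ, q.1 < 0 → DifferentiableAt ℝ w q := fun q hq =>
    (hW.contDiffAt (hn q hq)).differentiableAt (by norm_num)
  have dP1 : ∀ q : ℝ × ℝ, q.1 < 0 → DifferentiableAt ℝ P1 q := fun q hq =>
    (cP1.contDiffAt (hn q hq)).differentiableAt (by norm_num)
  have dP2 : ∀ q : ℝ × ℝ, q.1 < 0 → DifferentiableAt ℝ P2 q := fun q hq =>
    (cP2.contDiffAt (hn q hq)).differentiableAt (by norm_num)
  have eP1 : ∀ q : ℝ × ℝ, q.1 < 0 → pd1 Ψ q.1 q.2 = P1 q := fun q hq => by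
    rw [aux_pd1 Ψ q (dF q hq)]
    simp only [hP1, fderivWithin_of_mem_nhds (hn q hq), hF_def]
  have eP2 : ∀ q : ℝ × ℝ, q.1 < 0 → pd2 Ψ q.1 q.2 = P2 q := fun q hq => by
    rw [aux_pd2 Ψ q (dF q hq)]
    simp only [hP2, fderivWithin_of_mem_nhds (hn q hq), hF_def]
  have hP2bc : ∀ Z : ℝ, P2 (0, Z) = 0 := fun Z => by
    have := aux_pd2_within Ψ (0, Z) le_rfl (hΨ.differentiableOn (by norm_num) (0, Z) (by simp [hD]))
    rw [hbc Z] at this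
    exact this.symm
  -- symmetry of second derivatives
  have hsym : ∀ q : ℝ × ℝ, q.1 < 0 → fderiv ℝ P1 q (0, 1) = fderiv ℝ P2 q (1, 0) := by
    intro q hq
    have hcd := hΨ.contDiffAt (hn q hq)
    have hs := hcd.isSymmSndFDerivAt (by simp)
    have hdd : DifferentiableAt ℝ (fderivWithin ℝ F D) q :=
      (hF'.contDiffAt (hn q hq)).differentiableAt (by norm_num)
    have hee : fderivWithin ℝ F D =ᶠ[nhds q] fderiv ℝ F := by
      filter_upwards [(isOpen_Iio.preimage continuous_fst).mem_nhds hq] with x hx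
      exact fderivWithin_of_mem_nhds (hn x hx)
    have g1 : ∀ v : ℝ × ℝ, ∀ x, fderiv ℝ (fun y => fderivWithin ℝ F D y v) q x
        = fderiv ℝ (fderiv ℝ F) q x v := by
      intro v x
      rw [fderiv_clm_apply hdd (differentiableAt_const v), hee.fderiv_eq]
      simp
    simp only [hP1, hP2, g1]
    exact hs _ _
  -- gradient growth up to the boundary
  have hgr : ∀ ε > 0, ∃ M : ℝ, ∀ q : ℝ × ℝ, q.1 ≤ 0 → M < Real.sqrt (q.1 ^ 2 + q.2 ^ 2) →
      Real.sqrt (P1 q ^ 2 + P2 q ^ 2) ≤ ε * Real.sqrt (q.1 ^ 2 + q.2 ^ 2) := by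
    intro ε hε
    obtain ⟨M, hM⟩ := hgrad ε hε
    refine ⟨M, fun q hq hqM => ?_⟩
    have ho : IsOpen {q : ℝ × ℝ | M < Real.sqrt (q.1 ^ 2 + q.2 ^ 2)} :=
      isOpen_lt continuous_const (by fun_prop)
    have hcl : q ∈ closure ({q : ℝ × ℝ | M < Real.sqrt (q.1 ^ 2 + q.2 ^ 2)} ∩ {q : ℝ × ℝ | q.1 < 0}) :=
      ho.inter_closure ⟨hqM, aux_closure hq⟩
    have hsub : ({q : ℝ × ℝ | M < Real.sqrt (q.1 ^ 2 + q.2 ^ 2)} ∩ {q : ℝ × ℝ | q.1 < 0}) ⊆ D :=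
      fun x hx => (le_of_lt (hx.2 : x.1 < 0) : x.1 ≤ 0)
    refine ContinuousWithinAt.closure_le (f := fun q => Real.sqrt (P1 q ^ 2 + P2 q ^ 2))
      (g := fun q : ℝ × ℝ => ε * Real.sqrt (q.1 ^ 2 + q.2 ^ 2)) hcl ?_ ?_ ?_
    · exact ((((cP1.continuousOn.pow 2).add (cP2.continuousOn.pow 2)).sqrt) q hq).mono hsub
    · exact (by fun_prop : Continuous fun q : ℝ × ℝ => ε * Real.sqrt (q.1 ^ 2 + q.2 ^ 2)).continuousWithinAt
    · rintro x ⟨hx1, hx2⟩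
      have := hM x.1 (le_of_lt hx2) x.2 hx1
      rwa [eP1 x hx2, eP2 x hx2] at this
  -- the transport field
  set V1 : ℝ × ℝ → ℝ := fun q => γ * q.1 - P2 q with hV1
  set V2 : ℝ × ℝ → ℝ := fun q => γ * q.2 + P1 q with hV2
  have cV1 : ContinuousOn V1 D := (by fun_prop : Continuous fun q : ℝ × ℝ => γ * q.1).continuousOn.sub
    cP2.continuousOn
  have cV2 : ContinuousOn V2 D := (by fun_prop : Continuous fun q : ℝ × ℝ => γ * q.2).continuousOn.add
    cP1.continuousOn
  have fV1 : ∀ q : ℝ × ℝ, q.1 < 0 → HasFDerivAt V1 (γ • ContinuousLinearMap.fst ℝ ℝ ℝ - fderiv ℝ P2 q) q :=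
    fun q hq => (hasFDerivAt_fst.const_mul γ).sub (dP2 q hq).hasFDerivAt
  have fV2 : ∀ q : ℝ × ℝ, q.1 < 0 → HasFDerivAt V2 (γ • ContinuousLinearMap.snd ℝ ℝ ℝ + fderiv ℝ P1 q) q :=
    fun q hq => (hasFDerivAt_snd.const_mul γ).add (dP1 q hq).hasFDerivAt
  have hdiv : ∀ q : ℝ × ℝ, q.1 < 0 → fderiv ℝ V1 q (1, 0) + fderiv ℝ V2 q (0, 1) = 2 * γ := by
    intro q hq
    rw [(fV1 q hq).fderiv, (fV2 q hq).fderiv]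
    have := hsym q hq
    simp
    linarith
  have hVbc : ∀ Z : ℝ, V1 (0, Z) = 0 := fun Z => by simp [hV1, hP2bc]
  obtain ⟨M, hM⟩ := hgr 1 one_pos
  have hVb : ∀ q : ℝ × ℝ, q.1 ≤ 0 → M < Real.sqrt (q.1 ^ 2 + q.2 ^ 2) →
      |q.1 * V1 q + q.2 * V2 q| ≤ (γ + 1) * (q.1 ^ 2 + q.2 ^ 2) := by
    intro q hq hqM
    have h1 := hM q hq hqM
    rw [one_mul] at h1
    have h2 : P1 q ^ 2 + P2 q ^ 2 ≤ q.1 ^ 2 + q.2 ^ 2 := (Real.sqrt_le_sqrt_iff (by positivity)).1 h1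
    have h3 : |q.2 * P1 q - q.1 * P2 q| ≤ q.1 ^ 2 + q.2 ^ 2 := by
      apply abs_le_of_sq_le_sq _ (by positivity)
      nlinarith [sq_nonneg (q.1 * P1 q + q.2 * P2 q), sq_nonneg q.1, sq_nonneg q.2,
        mul_le_mul_of_nonneg_left h2 (by positivity : 0 ≤ q.1 ^ 2 + q.2 ^ 2)]
    have h4 : q.1 * V1 q + q.2 * V2 q = γ * (q.1 ^ 2 + q.2 ^ 2) + (q.2 * P1 q - q.1 * P2 q) := by
      simp only [hV1, hV2]; ring
    rw [h4]
    refine (abs_add_le _ _).trans ?_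
    rw [abs_of_nonneg (by positivity : 0 ≤ γ * (q.1 ^ 2 + q.2 ^ 2))]
    linarith
  obtain ⟨M', hM'⟩ := hdecay 1 one_pos
  have hu1 : ∀ q : ℝ × ℝ, q.1 ≤ 0 → M' < Real.sqrt (q.1 ^ 2 + q.2 ^ 2) → |u q| ≤ 1 := fun q h1 h2 => by
    have := hM' q.1 h1 q.2 h2
    simp only [hu_def]
    linarith [abs_nonneg (W q.1 q.2)]
  have hw1 : ∀ q : ℝ × ℝ, q.1 ≤ 0 → M' < Real.sqrt (q.1 ^ 2 + q.2 ^ 2) → |w q| ≤ 1 := fun q h1 h2 => by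
    have := hM' q.1 h1 q.2 h2
    simp only [hw_def]
    linarith [abs_nonneg (U q.1 q.2)]
  have U0 : ∀ q : ℝ × ℝ, q.1 < 0 → u q = 0 := by
    obtain ⟨k, hk1, hk2, hk3⟩ := aux_expo (1 - γ / 2) γ hγ p hp hpeven
    refine aux_transport γ (1 - γ / 2) k V1 V2 u hU.continuousOn cV1 cV2 du
      (fun q hq => (fV1 q hq).differentiableAt) (fun q hq => (fV2 q hq).differentiableAt)
      ?_ hdiv hVbc (γ + 1) M (by linarith) hVb hk1 hk3
      (aux_squeeze u w p (k + 1) hpeven hk1 hk2 hU.continuousOn hW.continuousOn M' hu1 hint)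
    intro q hq
    have := heqU q.1 hq.le q.2
    rw [eP1 q hq, eP2 q hq, aux_pd1 U q (du q hq), aux_pd2 U q (du q hq)] at this
    simp only [hV1, hV2]
    linear_combination this
  have W0 : ∀ q : ℝ × ℝ, q.1 < 0 → w q = 0 := by
    obtain ⟨k, hk1, hk2, hk3⟩ := aux_expo 1 γ hγ p hp hpeven
    have hint' := hint
    simp_rw [add_comm (U _ _ ^ p)] at hint'
    refine aux_transport γ 1 k V1 V2 w hW.continuousOn cV1 cV2 dw
      (fun q hq => (fV1 q hq).differentiableAt) (fun q hq => (fV2 q hq).differentiableAt)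
      ?_ hdiv hVbc (γ + 1) M (by linarith) hVb hk1 hk3
      (aux_squeeze w u p (k + 1) hpeven hk1 hk2 hW.continuousOn hU.continuousOn M' hw1 hint')
    intro q hq
    have := heqW q.1 hq.le q.2
    have hz : pd2 (fun a b => (U a b) ^ 2) q.1 q.2 = 0 := by
      have : (fun s => (U q.1 s) ^ 2) = fun _ => (0 : ℝ) := by
        ext s
        have := U0 (q.1, s) hq
        simp only [hu_def] at this
        simp [this]
      simp [pd2, this]
    rw [hz, eP1 q hq, eP2 q hq, aux_pd1 W q (dw q hq), aux_pd2 W q (dw q hq)] at this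
    simp only [hV1, hV2]
    linear_combination this
  refine ⟨fun R hR Z => ⟨?_, ?_⟩, ?_⟩
  · exact aux_ext u (fun _ => 0) hU.continuousOn continuousOn_const U0 (R, Z) hR
  · exact aux_ext w (fun _ => 0) hW.continuousOn continuousOn_const W0 (R, Z) hR
  have cr1 : ∀ q : ℝ × ℝ, q.1 < 0 → fderiv ℝ P1 q (1, 0) + fderiv ℝ P2 q (0, 1) = 0 := by
    intro q hq
    have h := heqΨ q.1 hq.le q.2
    have hw0 : W q.1 q.2 = 0 := W0 q hq
    have a1 : pd1 (pd1 Ψ) q.1 q.2 = fderiv ℝ P1 q (1, 0) := by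
      rw [← aux_pd1 (fun a b => P1 (a, b)) q (dP1 q hq)]
      apply Filter.EventuallyEq.deriv_eq
      filter_upwards [isOpen_Iio.mem_nhds hq] with s hs
      exact eP1 (s, q.2) hs
    have a2 : pd2 (pd2 Ψ) q.1 q.2 = fderiv ℝ P2 q (0, 1) := by
      rw [← aux_pd2 (fun a b => P2 (a, b)) q (dP2 q hq)]
      apply Filter.EventuallyEq.deriv_eq
      exact Eventually.of_forall fun s => eP2 (q.1, s) hq
    rw [a1, a2, hw0] at h
    linarith
  obtain ⟨a, ha⟩ := aux_liouville P1 P2 cP1 cP2 cr1 hsym hP2bc hgr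
  refine ⟨a, Ψ 0 0, fun R hR Z => ?_⟩
  have hconv : Convex ℝ D := by
    have : D = Set.Iic 0 ×ˢ Set.univ := by ext; simp [hD]
    rw [this]
    exact (convex_Iic 0).prod convex_univ
  have hder : ∀ q ∈ D, HasFDerivWithinAt (fun q : ℝ × ℝ => F q - a * q.1) (0 : ℝ × ℝ →L[ℝ] ℝ) D q := by
    intro q hq
    have h1 := (hΨ.differentiableOn (by norm_num) q hq).hasFDerivWithinAt
    have h2 : HasFDerivWithinAt (fun q : ℝ × ℝ => a * q.1) (a • ContinuousLinearMap.fst ℝ ℝ ℝ) D q :=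
      (hasFDerivAt_fst.const_mul a).hasFDerivWithinAt
    refine (h1.sub h2).congr_fderiv ?_
    have b1 : fderivWithin ℝ F D q (1, 0) = a := (ha q hq).1
    have b2 : fderivWithin ℝ F D q (0, 1) = 0 := (ha q hq).2
    ext <;> simp [b1, b2]
  have := hconv.is_const_of_fderivWithin_eq_zero (𝕜 := ℝ)
    (fun q hq => (hder q hq).differentiableWithinAt)
    (fun q hq => (hder q hq).fderivWithin (aux_uniq q hq)) (x := (R, Z)) (y := (0, 0)) hR
    (by simp [hD])
  simp only [hF_def] at this
  linarith
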